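/- The subgroup of GL(2,ℂ) generated by the matrices E, F, G (defined via a primitive 8th root of unity ζ as E = (1/2)·[[ζ³−ζ, −ζ³+ζ],[−ζ³+ζ, −ζ³+ζ]], F = (1/2)·[[ζ³−ζ, ζ³−ζ],[ζ³−ζ, −ζ³+ζ]], G = [[0, −ζ],[ζ³, 0]]) has order 48. -/

import Mathlib

open Matrix

namespace G12

/-- A matrix squaring to the identity, as an element of the general linear group. -/
def involution {n R : Type*} [Fintype n] [DecidableEq n] [CommRing R] (M : Matrix n n R)
    (h : M * M = 1) : GL n R :=
  ⟨M, M, h, h⟩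

/-- The reflection corresponding to `E` in a basis of roots, with entries in `ℤ[√-2]`. -/
def e : GL (Fin 2) (ℤ√(-2)) := involution !![-1, 0; ⟨1, -1⟩, 1] (by decide +kernel)

/-- The reflection corresponding to `F` in a basis of roots, with entries in `ℤ[√-2]`. -/
def f : GL (Fin 2) (ℤ√(-2)) := involution !![⟨-1, 1⟩, -2; ⟨-1, -1⟩, ⟨1, -1⟩] (by decide +kernel)

/-- The reflection corresponding to `G` in a basis of roots, with entries in `ℤ[√-2]`. -/
def g : GL (Fin 2) (ℤ√(-2)) := involution !![-1, ⟨-1, -1⟩; 0, 1] (by decide +kernel)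

/-- The elements of the group generated by `e`, `f`, `g`, factored through the Coxeter-like
element `e * f * g` of order `8`, the element `e * g` of order `3` and the reflection `e`. -/
def elements : Finset (GL (Fin 2) (ℤ√(-2))) :=
  (Finset.univ : Finset (Fin 8 × Fin 3 × Fin 2)).image fun x =>
    (e * f * g) ^ (x.1 : ℕ) * (e * g) ^ (x.2.1 : ℕ) * e ^ (x.2.2 : ℕ)

lemma card_elements : elements.card = 48 := by decide +kernel

lemma mul_mem_elements : ∀ x ∈ elements,
    e * x ∈ elements ∧ f * x ∈ elements ∧ g * x ∈ elements := by
  decide +kernel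

lemma coe_closure_eq_elements :
    (Subgroup.closure {e, f, g} : Set (GL (Fin 2) (ℤ√(-2)))) = elements := by
  have he : e ∈ Subgroup.closure {e, f, g} := Subgroup.subset_closure (by simp)
  have hf : f ∈ Subgroup.closure {e, f, g} := Subgroup.subset_closure (by simp)
  have hg : g ∈ Subgroup.closure {e, f, g} := Subgroup.subset_closure (by simp)
  have gen_mul_mem : ∀ x ∈ ({e, f, g} : Set (GL (Fin 2) (ℤ√(-2)))), ∀ y ∈ elements,
      x * y ∈ elements := by
    rintro x (rfl | rfl | rfl) y hy
    exacts [(mul_mem_elements y hy).1, (mul_mem_elements y hy).2.1, (mul_mem_elements y hy).2.2]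
  have inv_eq : ∀ x ∈ ({e, f, g} : Set (GL (Fin 2) (ℤ√(-2)))), x⁻¹ = x := by
    rintro x (rfl | rfl | rfl) <;> rfl
  ext x
  refine ⟨fun hx => ?_, fun hx => ?_⟩
  · induction hx using Subgroup.closure_induction_left with
    | one => exact Finset.mem_image.2 ⟨(0, 0, 0), Finset.mem_univ _, by simp⟩
    | mul_left x hx y _ hy => exact gen_mul_mem x hx y hy
    | inv_mul_cancel x hx y _ hy =>
      rw [inv_eq x hx]
      exact gen_mul_mem x hx y hy
  · obtain ⟨i, -, rfl⟩ := Finset.mem_image.1 hx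
    exact mul_mem (mul_mem (pow_mem (mul_mem (mul_mem he hf) hg) _) (pow_mem (mul_mem he hg) _))
      (pow_mem he _)

lemma card_closure : Nat.card (Subgroup.closure {e, f, g}) = 48 := by
  rw [← card_elements, ← SetLike.coe_sort_coe, coe_closure_eq_elements]
  simp

end G12

open G12 in
/-- The subgroup of GL(2,ℂ) generated by the matrices E, F, G of the reflection
representation of G₁₂ has order 48. -/
theorem g12_subgroup_card (ζ : ℂ) (hζ : IsPrimitiveRoot ζ 8)
    (E F G : Matrix.GeneralLinearGroup (Fin 2) ℂ)
    (hE : (E : Matrix (Fin 2) (Fin 2) ℂ) =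
      (1/2 : ℂ) • !![ζ^3 - ζ, -ζ^3 + ζ; -ζ^3 + ζ, -ζ^3 + ζ])
    (hF : (F : Matrix (Fin 2) (Fin 2) ℂ) =
      (1/2 : ℂ) • !![ζ^3 - ζ, ζ^3 - ζ; ζ^3 - ζ, -ζ^3 + ζ])
    (hG : (G : Matrix (Fin 2) (Fin 2) ℂ) = !![0, -ζ; ζ^3, 0]) :
    Nat.card (Subgroup.closure {E, F, G} : Subgroup (Matrix.GeneralLinearGroup (Fin 2) ℂ)) = 48 := by
  have h4 : ζ ^ 4 = -1 := by
    have h : (ζ ^ 4 - 1) * (ζ ^ 4 + 1) = 0 := by linear_combination hζ.pow_eq_one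
    rcases mul_eq_zero.1 h with h | h
    · exact absurd (sub_eq_zero.1 h) (hζ.pow_ne_one_of_pos_of_lt (by norm_num) (by norm_num))
    · exact eq_neg_of_add_eq_zero_left h
  have hζ0 : ζ ≠ 0 := hζ.ne_zero (by norm_num)
  let s : {r : ℂ // r * r = ((-2 : ℤ) : ℂ)} := ⟨ζ + ζ ^ 3, by
    push_cast
    linear_combination (ζ ^ 2 + 2) * h4⟩
  let φ : ℤ√(-2) →+* ℂ := Zsqrtd.lift s
  have hφ : Function.Injective φ := Zsqrtd.lift_injective s fun n hn => by
    nlinarith [mul_self_nonneg n]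
  have φ_mk (a b : ℤ) : φ ⟨a, b⟩ = a + b * (ζ + ζ ^ 3) := rfl
  have hdet : (!![2 * ζ, -1 + ζ + ζ ^ 2 - ζ ^ 3; 2, 1 + ζ + ζ ^ 2 + ζ ^ 3]).det ≠ 0 := by
    have : (!![2 * ζ, -1 + ζ + ζ ^ 2 - ζ ^ 3; 2, 1 + ζ + ζ ^ 2 + ζ ^ 3]).det = 4 * ζ ^ 3 := by
      rw [Matrix.det_fin_two_of]
      linear_combination 2 * h4
    simp [this, hζ0]
  let P : GL (Fin 2) ℂ := GeneralLinearGroup.mkOfDetNeZero _ hdet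
  have hP : (P : Matrix (Fin 2) (Fin 2) ℂ) =
    !![2 * ζ, -1 + ζ + ζ ^ 2 - ζ ^ 3; 2, 1 + ζ + ζ ^ 2 + ζ ^ 3] := rfl
  let ψ : GL (Fin 2) (ℤ√(-2)) →* GL (Fin 2) ℂ :=
    (MulAut.conj P).toMonoidHom.comp (GeneralLinearGroup.map φ)
  have hψ : Function.Injective ψ :=
    (MulAut.conj P).injective.comp (Units.map_injective (Matrix.map_injective hφ))
  have eq_of_mul_eq {x : GL (Fin 2) (ℤ√(-2))} {X : GL (Fin 2) ℂ}
      (h : (P : Matrix (Fin 2) (Fin 2) ℂ) * (x.val.map φ) = X * P) : ψ x = X :=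
    mul_inv_eq_of_eq_mul (Units.ext h)
  have he : ψ e = E := eq_of_mul_eq <| by
    rw [hP, hE]
    ext i j
    fin_cases i <;> fin_cases j <;>
      simp [e, involution, Matrix.mul_apply, Fin.sum_univ_two, φ_mk] <;> grind
  have hf : ψ f = F := eq_of_mul_eq <| by
    rw [hP, hF]
    ext i j
    fin_cases i <;> fin_cases j <;>
      simp [f, involution, Matrix.mul_apply, Fin.sum_univ_two, φ_mk] <;> grind
  have hg : ψ g = G := eq_of_mul_eq <| by
    rw [hP, hG]
    ext i j
    fin_cases i <;> fin_cases j <;>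
      simp [g, involution, Matrix.mul_apply, Fin.sum_univ_two, φ_mk] <;> grind
  have : Subgroup.closure {E, F, G} = (Subgroup.closure {e, f, g}).map ψ := by
    rw [MonoidHom.map_closure, Set.image_insert_eq, Set.image_pair, he, hf, hg]
  rw [this, Subgroup.card_map_of_injective hψ, card_closure]
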